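/- arXiv:1510.04050 — 2 statements merged into one kernel-verified Lean document; each statement's English description precedes it below -/
import Mathlib

section
/- For every integer n ≥ 3, every T_n-tangle of S is also a T_{n+1}-tangle: if a consistent orientation O of S has no subset in T_n, then O has no subset in T_{n+1}. -/
open Set

variable {V : Type*}

/-- `{A,B}` is a separation of `G`: `A ∪ B = V` and no edge between `A∖B` and `B∖A`. -/
def IsSep (G : SimpleGraph V) (A B : Set V) : Prop :=
  A ∪ B = Set.univ ∧ ∀ a ∈ A \ B, ∀ b ∈ B \ A, ¬ G.Adj a b

/-- A separation of finite order. -/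
def IsFinSep (G : SimpleGraph V) (A B : Set V) : Prop :=
  IsSep G A B ∧ (A ∩ B).Finite

/-- The set `S⃗` of oriented finite-order separations of `G`, as ordered pairs. -/
def Svec (G : SimpleGraph V) : Set (Set V × Set V) :=
  {p | IsFinSep G p.1 p.2}

/-- `(A,B) ≤ (C,D)` iff `A ⊆ C` and `D ⊆ B`. -/
def sepLE (p q : Set V × Set V) : Prop :=
  p.1 ⊆ q.1 ∧ q.2 ⊆ p.2

/-- An orientation of the set `S` of finite-order separations: a subset of `S⃗` containing
exactly one of `(A,B)`, `(B,A)` for every finite-order separation `{A,B}`. -/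
def IsOrientation (G : SimpleGraph V) (O : Set (Set V × Set V)) : Prop :=
  O ⊆ Svec G ∧ ∀ A B : Set V, IsFinSep G A B → ((A, B) ∈ O ↔ (B, A) ∉ O)

/-- Consistency: no two distinct members `(B,A)`, `(C,D)` with `(A,B) < (C,D)`. -/
def Consistent (O : Set (Set V × Set V)) : Prop :=
  ∀ A B C D : Set V, (B, A) ∈ O → (C, D) ∈ O → (B, A) ≠ (C, D) →
    ¬ (sepLE (A, B) (C, D) ∧ (A, B) ≠ (C, D))

/-- A star in `S⃗`: every two distinct elements point towards each other. -/
def IsStar (G : SimpleGraph V) (σ : Set (Set V × Set V)) : Prop :=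
  σ ⊆ Svec G ∧ ∀ p ∈ σ, ∀ q ∈ σ, p ≠ q → sepLE p (q.2, q.1)

/-- Membership in `T_n`: a star of at most `n` elements whose target sides have finite
intersection. -/
def InTn (G : SimpleGraph V) (n : ℕ) (σ : Set (Set V × Set V)) : Prop :=
  IsStar G σ ∧ σ.Finite ∧ σ.ncard ≤ n ∧ (⋂ p ∈ σ, p.2).Finite

/-- Membership in `T`: an arbitrary star whose target sides have finite intersection. -/
def InT (G : SimpleGraph V) (σ : Set (Set V × Set V)) : Prop :=
  IsStar G σ ∧ (⋂ p ∈ σ, p.2).Finite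

/-- An `ℵ₀`-tangle of `G`: a consistent orientation of `S` with no subset in `T₃`. -/
def IsTangle (G : SimpleGraph V) (τ : Set (Set V × Set V)) : Prop :=
  IsOrientation G τ ∧ Consistent τ ∧ ∀ σ ⊆ τ, ¬ InTn G 3 σ

/-- A `T`-tangle of `S`: a consistent orientation of `S` with no subset in `T`. -/
def IsTTangle (G : SimpleGraph V) (τ : Set (Set V × Set V)) : Prop :=
  IsOrientation G τ ∧ Consistent τ ∧ ∀ σ ⊆ τ, ¬ InT G σ

/-- The set `𝒞_X` of (vertex sets of) connected components of `G − X`. -/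
def Comps (G : SimpleGraph V) (X : Set V) : Set (Set V) :=
  {C | ∃ c : (G.induce Xᶜ).ConnectedComponent, C = Subtype.val '' c.supp}

/-- A collection of subsets of `α` is an ultrafilter on `α`. -/
def IsUltra {α : Type*} (F : Set (Set α)) : Prop :=
  ∅ ∉ F ∧ (∀ s ∈ F, ∀ t ∈ F, s ∩ t ∈ F) ∧ (∀ s ∈ F, ∀ t : Set α, s ⊆ t → t ∈ F) ∧
    ∀ s : Set α, s ∈ F ∨ sᶜ ∈ F

/-- A principal ultrafilter, generated by a single point. -/
def IsPrincipalUF {α : Type*} (F : Set (Set α)) : Prop :=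
  ∃ a : α, F = {s | a ∈ s}

/-- `U(τ,X)`: the collection of all sets `𝒮` of components of `G − X` with
`(⋃(𝒞_X∖𝒮) ∪ X, ⋃𝒮 ∪ X) ∈ τ`. -/
def tangleUF (G : SimpleGraph V) (τ : Set (Set V × Set V)) (X : Set V) :
    Set (Set ↥(Comps G X)) :=
  {𝒮 | ((⋃ C ∈ 𝒮ᶜ, (C : Set V)) ∪ X, (⋃ C ∈ 𝒮, (C : Set V)) ∪ X) ∈ τ}

/-- `f_{X',X}`: the pushforward of an ultrafilter on `𝒞_{X'}` along the map sending each
component of `G − X'` to the component of `G − X` containing it. -/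
def pushUF (G : SimpleGraph V) (X X' : Set V) (F : Set (Set ↥(Comps G X'))) :
    Set (Set ↥(Comps G X)) :=
  {𝒮 | {C' : ↥(Comps G X') | ∃ C ∈ 𝒮, (C' : Set V) ⊆ (C : Set V)} ∈ F}

/-- A direction in `G`: a choice of a component of `G − X` for every finite `X ⊆ V`,
compatible under inclusion. -/
def IsDirection (G : SimpleGraph V) (f : Set V → Set V) : Prop :=
  (∀ X : Set V, X.Finite → f X ∈ Comps G X) ∧
    ∀ X X' : Set V, X.Finite → X'.Finite → X ⊆ X' → f X' ⊆ f X

/-- The supremum `(A ∪ C, B ∩ D)` of two finite-order separations has finite order. -/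
theorem IsFinSep.sup {G : SimpleGraph V} {A B C D : Set V} (h₁ : IsFinSep G A B)
    (h₂ : IsFinSep G C D) : IsFinSep G (A ∪ C) (B ∩ D) := by
  obtain ⟨⟨u₁, e₁⟩, f₁⟩ := h₁
  obtain ⟨⟨u₂, e₂⟩, f₂⟩ := h₂
  rw [Set.eq_univ_iff_forall] at u₁ u₂
  refine ⟨⟨?_, ?_⟩, (f₁.union f₂).subset ?_⟩
  · refine Set.eq_univ_of_forall fun x => ?_
    have h₁ := u₁ x
    have h₂ := u₂ x
    simp only [mem_union, mem_inter_iff] at *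
    tauto
  · rintro a ⟨-, ha⟩ b ⟨⟨hb₁, hb₂⟩, hb⟩
    rw [mem_union, not_or] at hb
    by_cases h : a ∈ B
    · have h' : a ∉ D := fun hD => ha ⟨h, hD⟩
      exact e₂ a ⟨(u₂ a).resolve_right h', h'⟩ b ⟨hb₂, hb.2⟩
    · exact e₁ a ⟨(u₁ a).resolve_right h, h⟩ b ⟨hb₁, hb.1⟩
  · rintro x ⟨hx | hx, hB, hD⟩
    · exact Or.inl ⟨hx, hB⟩
    · exact Or.inr ⟨hx, hD⟩

theorem IsFinSep.symm {G : SimpleGraph V} {A B : Set V} (h : IsFinSep G A B) :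
    IsFinSep G B A :=
  ⟨⟨Set.union_comm A B ▸ h.1.1, fun b hb a ha hab => h.1.2 a ha b hb hab.symm⟩,
    Set.inter_comm A B ▸ h.2⟩

/-- Two separations pointing towards each other, with the inverse of their supremum, form a
star in `T_n` for every `n ≥ 3`. -/
theorem inTn_triple {G : SimpleGraph V} {n : ℕ} (hn : 3 ≤ n) {p q : Set V × Set V}
    (hp : p ∈ Svec G) (hq : q ∈ Svec G) (hpq : sepLE p (q.2, q.1)) :
    InTn G n {p, q, (p.2 ∩ q.2, p.1 ∪ q.1)} := by
  obtain ⟨A, B⟩ := p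
  obtain ⟨C, D⟩ := q
  have hs : IsFinSep G (A ∪ C) (B ∩ D) := IsFinSep.sup hp hq
  refine ⟨⟨?_, ?_⟩, by simp, (Set.ncard_insert_le _ _).trans ?_, hs.2.subset ?_⟩
  · rintro x (rfl | rfl | rfl)
    exacts [hp, hq, hs.symm]
  · simp only [sepLE] at hpq
    rintro x (rfl | rfl | rfl) y (rfl | rfl | rfl) hxy <;> simp_all [sepLE]
  · have := Set.ncard_insert_le (C, D) {(B ∩ D, A ∪ C)}
    rw [Set.ncard_singleton] at this
    lia
  · intro x hx
    simp_all

/-- Replacing two elements of a star in `T_{n+1}` by their supremum gives a star in `T_n`. -/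
theorem InTn.merge {G : SimpleGraph V} {n : ℕ} {σ : Set (Set V × Set V)}
    (h : InTn G (n + 1) σ) {p q : Set V × Set V} (hp : p ∈ σ) (hq : q ∈ σ) (hpq : p ≠ q) :
    InTn G n (insert (p.1 ∪ q.1, p.2 ∩ q.2) (σ \ {p, q})) := by
  obtain ⟨⟨hS, hst⟩, hfin, hcard, hint⟩ := h
  have hr : ∀ x ∈ σ \ {p, q}, x.1 ⊆ p.2 ∩ q.2 ∧ p.1 ∪ q.1 ⊆ x.2 := by
    rintro x ⟨hx, hne⟩
    simp only [mem_insert_iff, mem_singleton_iff, not_or] at hne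
    have h₁ := hst x hx p hp hne.1
    have h₂ := hst x hx q hq hne.2
    exact ⟨subset_inter h₁.1 h₂.1, union_subset h₁.2 h₂.2⟩
  refine ⟨⟨?_, ?_⟩, hfin.sdiff.insert _, (Set.ncard_insert_le _ _).trans ?_, hint.subset ?_⟩
  · rintro x (rfl | hx)
    exacts [IsFinSep.sup (hS hp) (hS hq), hS hx.1]
  · rintro x (rfl | hx) y (rfl | hy) hxy
    · exact absurd rfl hxy
    · exact ⟨(hr y hy).2, (hr y hy).1⟩
    · exact hr x hx
    · exact hst x hx.1 y hy.1 hxy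
  · have := Set.ncard_sdiff_add_ncard_of_subset (s := {p, q}) (t := σ)
      (by rintro x (rfl | rfl) <;> assumption) hfin
    rw [Set.ncard_pair hpq] at this
    lia
  · intro x hx
    rw [mem_iInter₂] at hx ⊢
    have hx₀ := hx _ (mem_insert _ _)
    intro y hy
    by_cases hyp : y = p
    · exact hyp ▸ hx₀.1
    by_cases hyq : y = q
    · exact hyq ▸ hx₀.2
    exact hx y (mem_insert_of_mem _ ⟨hy, by simp [hyp, hyq]⟩)

/-- Lemma 1.4: for `n ≥ 3`, every `T_n`-tangle of `S` is a `T_{n+1}`-tangle. -/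
theorem stmt3 [Infinite V] (G : SimpleGraph V) (n : ℕ) (hn : 3 ≤ n)
    (O : Set (Set V × Set V)) (hO : IsOrientation G O) (hc : Consistent O)
    (h : ∀ σ ⊆ O, ¬ InTn G n σ) :
    ∀ σ ⊆ O, ¬ InTn G (n + 1) σ := by
  intro σ hσ hT
  obtain hle | hlt := le_or_gt σ.ncard n
  · exact h σ hσ ⟨hT.1, hT.2.1, hle, hT.2.2.2⟩
  obtain ⟨p, hp, q, hq, hpq⟩ := (Set.one_lt_ncard hT.2.1).1 (show 1 < σ.ncard by lia)
  have hs : IsFinSep G (p.1 ∪ q.1) (p.2 ∩ q.2) := IsFinSep.sup (hT.1.1 hp) (hT.1.1 hq)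
  by_cases hr : (p.1 ∪ q.1, p.2 ∩ q.2) ∈ O
  · exact h _ (insert_subset hr (sdiff_subset.trans hσ)) (hT.merge hp hq hpq)
  · refine h _ ?_ (inTn_triple hn (hT.1.1 hp) (hT.1.1 hq) (hT.1.2 p hp q hq hpq))
    rintro x (rfl | rfl | rfl)
    exacts [hσ hp, hσ hq, (hO.2 _ _ hs.symm).2 hr]
end

section
/- For every ℵ₀-tangle τ of G, the ultrafilter U(τ,X) is principal for every finite X ⊆ V if and only if there is a direction f in G such that, for every finite X ⊆ V, U(τ,X) is the principal ultrafilter on 𝒞_X generated by {f(X)}. -/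
open Set

variable {V : Type*}

theorem mem_comps_iff {G : SimpleGraph V} {X C : Set V} :
    C ∈ Comps G X ↔ ∃ u : ↥Xᶜ, C = {v | ∃ h : v ∈ Xᶜ, (G.induce Xᶜ).Reachable ⟨v, h⟩ u} := by
  constructor
  · rintro ⟨c, rfl⟩
    obtain ⟨u, rfl⟩ := c.exists_rep
    refine ⟨u, ?_⟩
    ext v
    simp only [mem_image, Subtype.exists, exists_and_right, exists_eq_right, mem_ofPred_eq]
    exact exists_congr fun h => SimpleGraph.ConnectedComponent.eq
  · rintro ⟨u, rfl⟩
    refine ⟨(G.induce Xᶜ).connectedComponentMk u, ?_⟩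
    ext v
    simp only [mem_image, Subtype.exists, exists_and_right, exists_eq_right, mem_ofPred_eq]
    exact exists_congr fun h => SimpleGraph.ConnectedComponent.eq.symm

theorem notMem_of_mem_comps {G : SimpleGraph V} {X C : Set V} (hC : C ∈ Comps G X) {v : V}
    (hv : v ∈ C) : v ∉ X := by
  obtain ⟨u, rfl⟩ := mem_comps_iff.1 hC
  exact hv.1

theorem exists_mem_comps {G : SimpleGraph V} {X : Set V} {v : V} (hv : v ∉ X) :
    ∃ C ∈ Comps G X, v ∈ C :=
  ⟨_, mem_comps_iff.2 ⟨⟨v, hv⟩, rfl⟩, hv, SimpleGraph.Reachable.refl _⟩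

theorem mem_comps_of_adj {G : SimpleGraph V} {X C : Set V} (hC : C ∈ Comps G X) {v w : V}
    (hv : v ∈ C) (hw : w ∉ X) (h : G.Adj v w) : w ∈ C := by
  obtain ⟨u, rfl⟩ := mem_comps_iff.1 hC
  obtain ⟨hvX, hvu⟩ := hv
  have hadj : (G.induce Xᶜ).Adj ⟨w, hw⟩ ⟨v, hvX⟩ := h.symm
  exact ⟨hw, hadj.reachable.trans hvu⟩

/-- A component of `G − X'` that meets a component of `G − X`, where `X ⊆ X'`, lies in it. -/
theorem comps_subset_of_mem {G : SimpleGraph V} {X X' C C' : Set V} (hX : X ⊆ X')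
    (hC : C ∈ Comps G X) (hC' : C' ∈ Comps G X') {v : V} (hv : v ∈ C) (hv' : v ∈ C') :
    C' ⊆ C := by
  obtain ⟨u, rfl⟩ := mem_comps_iff.1 hC
  obtain ⟨u', rfl⟩ := mem_comps_iff.1 hC'
  obtain ⟨hvX, hvu⟩ := hv
  obtain ⟨hvX', hvu'⟩ := hv'
  rintro w ⟨hw, hwu'⟩
  have hwv := (hwu'.trans hvu'.symm).map
    (SimpleGraph.induceHomOfLE G (compl_subset_compl.2 hX)).toHom
  exact ⟨fun h => hw (hX h), SimpleGraph.Reachable.trans hwv hvu⟩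

/-- An `ℵ₀`-tangle is closed downwards. -/
theorem IsTangle.mem_of_sepLE {G : SimpleGraph V} {τ : Set (Set V × Set V)} (hτ : IsTangle G τ)
    {A B C D : Set V} (hAB : IsFinSep G A B) (hCD : (C, D) ∈ τ)
    (hle : sepLE (A, B) (C, D)) : (A, B) ∈ τ := by
  by_contra hn
  have hBA : (B, A) ∈ τ := (hτ.1.2 B A hAB.symm).2 hn
  by_cases heq : (B, A) = (C, D)
  · obtain ⟨rfl, rfl⟩ := Prod.mk.inj heq
    refine hτ.2.2 {(B, A)} (singleton_subset_iff.2 hBA)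
      ⟨⟨singleton_subset_iff.2 hAB.symm, ?_⟩, finite_singleton _, by simp, ?_⟩
    · rintro p rfl q rfl h
      exact absurd rfl h
    · have hfin := hAB.2
      rw [inter_eq_left.2 hle.1] at hfin
      simpa using hfin
  · exact hτ.2.1 A B C D hBA hCD heq ⟨hle, fun h => hn (h ▸ hCD)⟩

theorem IsTangle.not_finite_inter {G : SimpleGraph V} {τ : Set (Set V × Set V)}
    (hτ : IsTangle G τ) {p q : Set V × Set V} (hp : p ∈ τ) (hq : q ∈ τ)
    (hpq : sepLE p (q.2, q.1)) : ¬ (p.2 ∩ q.2).Finite := by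
  intro hfin
  refine hτ.2.2 {p, q} (pair_subset hp hq)
    ⟨⟨pair_subset (hτ.1.1 hp) (hτ.1.1 hq), ?_⟩, toFinite _,
      (ncard_insert_le p {q}).trans (by simp), by simpa using hfin⟩
  rintro x (rfl | rfl) y (rfl | rfl) hxy
  · exact absurd rfl hxy
  · exact hpq
  · exact ⟨hpq.2, hpq.1⟩
  · exact absurd rfl hxy

theorem isFinSep_of_mem_comps {G : SimpleGraph V} {X Y Z C : Set V} (hC : C ∈ Comps G X)
    (hXY : X ⊆ Y) (hY : Y.Finite) (hZ : Z.Finite) : IsFinSep G (C ∪ Y) (C \ Z)ᶜ := by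
  refine ⟨⟨?_, ?_⟩, (hY.union hZ).subset ?_⟩
  · ext v
    simp only [mem_union, mem_compl_iff, mem_sdiff, mem_univ, iff_true]
    tauto
  · rintro a ⟨-, ha⟩ b ⟨-, hb⟩ hab
    exact hb (.inl (mem_comps_of_adj hC (not_not.1 ha).1 (fun h => hb (.inr (hXY h))) hab))
  · rintro v ⟨hv, hv'⟩
    simp only [mem_union, mem_compl_iff, mem_sdiff] at *
    tauto

/-- If `{C}` belongs to `U(τ,X)` and `X ⊆ X'`, then the set of components of `G − X'` contained
in `C` belongs to `U(τ,X')`. -/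
theorem IsTangle.setOf_subset_mem_tangleUF {G : SimpleGraph V} {τ : Set (Set V × Set V)}
    (hτ : IsTangle G τ) {X X' : Set V} (hX : X.Finite) (hX' : X'.Finite) (hXX' : X ⊆ X')
    (C : ↥(Comps G X)) (hC : {C} ∈ tangleUF G τ X) :
    {C' : ↥(Comps G X') | (C' : Set V) ⊆ C} ∈ tangleUF G τ X' := by
  obtain ⟨C, hCX⟩ := C
  have hleft : (⋃ D ∈ ({⟨C, hCX⟩} : Set ↥(Comps G X))ᶜ, (D : Set V)) ∪ X = Cᶜ := by
    ext v
    simp only [mem_union, mem_iUnion, mem_compl_iff, mem_singleton_iff, exists_prop]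
    constructor
    · rintro (⟨D, hD, hv⟩ | hv) hvC
      · exact hD (Subtype.ext (subset_antisymm
          (comps_subset_of_mem subset_rfl hCX D.2 hvC hv)
          (comps_subset_of_mem subset_rfl D.2 hCX hv hvC)))
      · exact notMem_of_mem_comps hCX hvC hv
    · intro hv
      by_cases hvX : v ∈ X
      · exact .inr hvX
      · obtain ⟨D, hD, hvD⟩ := exists_mem_comps (G := G) hvX
        refine .inl ⟨⟨D, hD⟩, fun h => hv ?_, hvD⟩
        exact Subtype.mk.inj h ▸ hvD
  have hp : (Cᶜ, C ∪ X) ∈ τ := by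
    have h : (_, _) ∈ τ := hC
    rwa [hleft, biUnion_singleton] at h
  have hright' : (⋃ D ∈ {C' : ↥(Comps G X') | (C' : Set V) ⊆ C}, (D : Set V)) ∪ X' =
      C ∪ X' := by
    ext v
    simp only [mem_union, mem_iUnion, mem_ofPred_eq, exists_prop]
    constructor
    · rintro (⟨D, hD, hv⟩ | hv)
      exacts [.inl (hD hv), .inr hv]
    · intro hv
      by_cases hvX : v ∈ X'
      · exact .inr hvX
      · obtain ⟨D, hD, hvD⟩ := exists_mem_comps (G := G) hvX
        exact .inl ⟨⟨D, hD⟩,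
          comps_subset_of_mem hXX' hCX hD (hv.resolve_right hvX) hvD, hvD⟩
  have hleft' : (⋃ D ∈ {C' : ↥(Comps G X') | (C' : Set V) ⊆ C}ᶜ, (D : Set V)) ∪ X' =
      (C \ X')ᶜ := by
    ext v
    simp only [mem_union, mem_iUnion, mem_compl_iff, mem_ofPred_eq, exists_prop]
    constructor
    · rintro (⟨D, hD, hv⟩ | hv) hvC
      · exact hD (comps_subset_of_mem hXX' hCX D.2 hvC.1 hv)
      · exact hvC.2 hv
    · intro hv
      by_cases hvX : v ∈ X'
      · exact .inr hvX
      · obtain ⟨D, hD, hvD⟩ := exists_mem_comps (G := G) hvX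
        exact .inl ⟨⟨D, hD⟩, fun h => hv ⟨h hvD, hvX⟩, hvD⟩
  change (_, _) ∈ τ
  rw [hleft', hright']
  rw [hτ.1.2 _ _ (isFinSep_of_mem_comps hCX hXX' hX' hX').symm]
  intro hr
  have hq : (C ∪ X, (C \ X')ᶜ) ∈ τ :=
    hτ.mem_of_sepLE (isFinSep_of_mem_comps hCX subset_rfl hX hX') hr
      ⟨union_subset_union_right _ hXX', subset_rfl⟩
  refine hτ.not_finite_inter hp hq ⟨compl_subset_compl.2 sdiff_subset, subset_rfl⟩ ?_
  exact (isFinSep_of_mem_comps hCX subset_rfl hX hX').2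

/-- Lemma 2.4: `U(τ,X)` is principal for every finite `X` iff there is a
direction `f` in `G` with `U(τ,X)` the principal ultrafilter generated by `{f(X)}` for
every finite `X`. -/
theorem stmt10 [Infinite V] (G : SimpleGraph V) (τ : Set (Set V × Set V))
    (hτ : IsTangle G τ) :
    (∀ X : Set V, X.Finite → IsPrincipalUF (tangleUF G τ X)) ↔
      ∃ f : Set V → Set V, IsDirection G f ∧
        ∀ X : Set V, X.Finite →
          ∃ C : ↥(Comps G X), (C : Set V) = f X ∧
            tangleUF G τ X = {𝒮 : Set ↥(Comps G X) | C ∈ 𝒮} := by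
  refine ⟨fun h => ?_, fun ⟨f, _, hf⟩ X hX => ?_⟩
  · choose a ha using h
    classical
    let f : Set V → Set V := fun X => if hX : X.Finite then (a X hX : Set V) else ∅
    have hfa : ∀ X (hX : X.Finite), f X = a X hX := fun X hX => dif_pos hX
    refine ⟨f, ⟨fun X hX => ?_, fun X X' hX hX' hXX' => ?_⟩,
      fun X hX => ⟨a X hX, (hfa X hX).symm, ha X hX⟩⟩
    · rw [hfa X hX]
      exact (a X hX).2
    · rw [hfa X hX, hfa X' hX']
      have hmem : {a X hX} ∈ tangleUF G τ X := by
        rw [ha X hX]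
        exact mem_singleton _
      have hsub := hτ.setOf_subset_mem_tangleUF hX hX' hXX' (a X hX) hmem
      rw [ha X' hX'] at hsub
      exact hsub
  · obtain ⟨C, -, hC⟩ := hf X hX
    exact ⟨C, hC⟩
end
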